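/- Let φ : ℕ → ℝ^m be a bounded sequence that is persistently exciting: there exist α > 0 and an integer K ≥ 1 (with K ≥ m) such that ∑_{j=k+1}^{k+K} φ(j)·φ(j)ᵀ ⪰ α·I_m for all k ≥ 0. Fix an integer K̄ ≥ K and define Φ(k) := ∑_{j=k+1}^{k+K̄} φ(j)·φ(j)ᵀ and Δ(k) := det(Φ(k)). Then Δ is persistently exciting; in fact Δ(k)² ≥ α^{2m} for all k ≥ 0, so for every window length L ≥ 1, ∑_{j=k+1}^{k+L} Δ(j)² ≥ α^{2m} for all k ≥ 0. -/

import Mathlib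

open Finset Matrix

/-- If `A - α • 1` is positive semidefinite with `0 ≤ α`, then every eigenvalue of `A` is at
least `α`, hence `det A` is at least `α` to the power of the dimension. -/
theorem pow_card_le_det_of_posSemidef_sub_smul_one {n : Type*} [Fintype n] [DecidableEq n]
    {A : Matrix n n ℝ} {α : ℝ} (hα : 0 ≤ α)
    (h : (A - α • (1 : Matrix n n ℝ)).PosSemidef) : α ^ Fintype.card n ≤ A.det := by
  have hA : A.IsHermitian := by
    simpa using (h.add (PosSemidef.one.smul hα)).isHermitian
  have hle : ∀ i, α ≤ hA.eigenvalues i := fun i ↦ by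
    have hi : hA.eigenvalues i - α ∈ spectrum ℝ (A - α • (1 : Matrix n n ℝ)) := by
      rw [← Algebra.algebraMap_eq_smul_one, ← spectrum.sub_singleton_eq]
      exact Set.sub_mem_sub (hA.eigenvalues_mem_spectrum_real i) rfl
    rw [h.isHermitian.spectrum_real_eq_range_eigenvalues] at hi
    obtain ⟨j, hj⟩ := hi
    linarith [h.eigenvalues_nonneg j]
  calc α ^ Fintype.card n = ∏ _i : n, α := by simp
    _ ≤ ∏ i, hA.eigenvalues i := Finset.prod_le_prod (fun _ _ ↦ hα) fun i _ ↦ hle i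
    _ = A.det := by simp [hA.det_eq_prod_eigenvalues]

/-- If the regressor `φ` is persistently exciting, then the determinant `Δ` of the
extended regressor matrix is persistently exciting: `Δ(k)² ≥ α^{2m}` for all `k`, so
every window of any length `L ≥ 1` carries at least `α^{2m}` of excitation. -/
theorem drem_det_pe_of_pe {m : ℕ} (hm : 1 ≤ m) (φ : ℕ → Fin m → ℝ)
    (M : ℝ) (hbdd : ∀ k, Real.sqrt (∑ i, (φ k i) ^ 2) ≤ M)
    (α : ℝ) (hα : 0 < α) (K : ℕ) (hK : 1 ≤ K) (hKm : m ≤ K)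
    (hPE : ∀ k : ℕ,
      ((∑ j ∈ Finset.Icc (k + 1) (k + K), vecMulVec (φ j) (φ j)) -
        α • (1 : Matrix (Fin m) (Fin m) ℝ)).PosSemidef)
    (Kbar : ℕ) (hKbar : K ≤ Kbar)
    (Φ : ℕ → Matrix (Fin m) (Fin m) ℝ)
    (hΦ : ∀ k, Φ k = ∑ j ∈ Finset.Icc (k + 1) (k + Kbar), vecMulVec (φ j) (φ j))
    (Δ : ℕ → ℝ) (hΔ : ∀ k, Δ k = (Φ k).det) :
    (∀ k : ℕ, α ^ (2 * m) ≤ (Δ k) ^ 2) ∧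
      ∀ L : ℕ, 1 ≤ L → ∀ k : ℕ,
        α ^ (2 * m) ≤ ∑ j ∈ Finset.Icc (k + 1) (k + L), (Δ j) ^ 2 := by
  have hsq : ∀ k, α ^ (2 * m) ≤ (Δ k) ^ 2 := fun k ↦ by
    have hpsd : (Φ k - α • (1 : Matrix (Fin m) (Fin m) ℝ)).PosSemidef := by
      have hsub : Finset.Icc (k + 1) (k + K) ⊆ Finset.Icc (k + 1) (k + Kbar) :=
        Finset.Icc_subset_Icc_right (by omega)
      rw [hΦ, ← Finset.sum_sdiff hsub, add_sub_assoc]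
      refine PosSemidef.add (posSemidef_sum _ fun j _ ↦ ?_) (hPE k)
      simpa using posSemidef_vecMulVec_self_star (φ j)
    have hdet := pow_card_le_det_of_posSemidef_sub_smul_one hα.le hpsd
    rw [Fintype.card_fin, ← hΔ] at hdet
    rw [mul_comm, pow_mul]
    gcongr
  refine ⟨hsq, fun L hL k ↦ (hsq (k + 1)).trans ?_⟩
  exact Finset.single_le_sum (f := fun j ↦ (Δ j) ^ 2) (fun _ _ ↦ sq_nonneg _)
    (Finset.mem_Icc.2 ⟨le_rfl, by omega⟩)
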